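/- Let n, m be positive integers with m < n. Let E ⊆ ℝⁿ be an m-rectifiable set (ℋᵐ-measurable, ℋᵐ(E) > 0, covered up to an ℋᵐ-null set by countably many C¹ embeddings of ℝᵐ into ℝⁿ) which is not essentially m-flat. Then the exceptional set {x ∈ ℝⁿ : ℋᵐ(π_x(E \ {x})) = 0} is contained in some affine (m−1)-plane of ℝⁿ (where an affine 0-plane is a singleton). -/

import Mathlib

open MeasureTheory Metric Set
open scoped ENNReal

/-- The radial projection from `x`, mapping `y ≠ x` to `(y - x)/‖y - x‖ ∈ S^{n-1}`. -/
noncomputable def radialProj {n : ℕ} (x y : EuclideanSpace ℝ (Fin n)) : EuclideanSpace ℝ (Fin n) :=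
  ‖y - x‖⁻¹ • (y - x)

/-- A `C¹` embedding: continuously differentiable and a homeomorphism onto its image. -/
def IsC1Embedding {m n : ℕ} (f : EuclideanSpace ℝ (Fin m) → EuclideanSpace ℝ (Fin n)) : Prop :=
  ContDiff ℝ 1 f ∧ Topology.IsEmbedding f

/-- `T` is an affine `k`-plane: a translate of a `k`-dimensional linear subspace. -/
def IsAffinePlane {n : ℕ} (k : ℕ) (T : Set (EuclideanSpace ℝ (Fin n))) : Prop :=
  ∃ (W : Submodule ℝ (EuclideanSpace ℝ (Fin n))) (v : EuclideanSpace ℝ (Fin n)),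
    Module.finrank ℝ W = k ∧ T = (fun w => v + w) '' (W : Set (EuclideanSpace ℝ (Fin n)))

/-- `E` is `m`-rectifiable: `ℋᵐ`-measurable, of positive `ℋᵐ` measure, and covered up to an
`ℋᵐ`-null set by countably many `C¹` embeddings of `ℝᵐ` into `ℝⁿ`. -/
def IsRectifiableSet (m n : ℕ) (E : Set (EuclideanSpace ℝ (Fin n))) : Prop :=
  NullMeasurableSet E (μH[(m : ℝ)]) ∧ 0 < μH[(m : ℝ)] E ∧
  ∃ f : ℕ → (EuclideanSpace ℝ (Fin m) → EuclideanSpace ℝ (Fin n)),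
    (∀ i, IsC1Embedding (f i)) ∧ μH[(m : ℝ)] (E \ ⋃ i, Set.range (f i)) = 0

section HausdorffMeasureImage

variable {E F : Type*}
  [NormedAddCommGroup E] [InnerProductSpace ℝ E] [FiniteDimensional ℝ E]
  [MeasurableSpace E] [BorelSpace E]
  [NormedAddCommGroup F] [NormedSpace ℝ F] [MeasurableSpace F] [BorelSpace F]

/-- If distances between `f`-images are controlled by distances between `g`-images, then so are
the Hausdorff measures of the images. -/
lemma hausdorffMeasure_image_le_of_dist_le {X Y Z : Type*} [MetricSpace Y] [MeasurableSpace Y]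
    [BorelSpace Y] [MetricSpace Z] [MeasurableSpace Z] [BorelSpace Z]
    {f : X → Y} {g : X → Z} {s : Set X} {K : NNReal} {d : ℝ} (hd : 0 ≤ d)
    (h : ∀ a ∈ s, ∀ b ∈ s, dist (f a) (f b) ≤ K * dist (g a) (g b)) :
    μH[d] (f '' s) ≤ (K : ℝ≥0∞) ^ d * μH[d] (g '' s) := by
  rcases s.eq_empty_or_nonempty with rfl | ⟨x₀, -⟩
  · simp
  have : Nonempty X := ⟨x₀⟩
  have hmem : ∀ y ∈ g '' s, Function.invFunOn g s y ∈ s := fun y hy => Function.invFunOn_mem hy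
  have heq : ∀ y ∈ g '' s, g (Function.invFunOn g s y) = y := fun y hy => Function.invFunOn_eq hy
  have hlip : LipschitzOnWith K (f ∘ Function.invFunOn g s) (g '' s) := by
    refine LipschitzOnWith.of_dist_le_mul fun y hy z hz => ?_
    have := h _ (hmem y hy) _ (hmem z hz)
    rwa [heq y hy, heq z hz] at this
  refine le_trans (measure_mono ?_) (hlip.hausdorffMeasure_image_le hd)
  rintro _ ⟨a, ha, rfl⟩
  refine ⟨g a, mem_image_of_mem g ha, ?_⟩
  have hga := mem_image_of_mem g ha
  have := h _ (hmem _ hga) a ha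
  rw [heq _ hga, dist_self, mul_zero] at this
  exact dist_le_zero.1 this

/-- A map well approximated by a non-injective linear map contracts Hausdorff measure
by an arbitrarily large factor. -/
lemma exists_hausdorffMeasure_image_le_of_not_injective (A : E →L[ℝ] F)
    (hA : ¬ Function.Injective A) {η : NNReal} (hη : 0 < η) :
    ∃ δ : NNReal, 0 < δ ∧ ∀ (f : E → F) (s : Set E), ApproximatesLinearOn f A s δ →
      μH[(Module.finrank ℝ E : ℝ)] (f '' s) ≤ η * μH[(Module.finrank ℝ E : ℝ)] s := by
  obtain ⟨v, hv, hAv⟩ : ∃ v : E, ‖v‖ = 1 ∧ A v = 0 := by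
    rw [injective_iff_map_eq_zero] at hA
    push Not at hA
    obtain ⟨w, hw, hw0⟩ := hA
    exact ⟨‖w‖⁻¹ • w, norm_smul_inv_norm hw0, by simp [hw]⟩
  set K : NNReal := 2 * ‖A‖₊ + 3 with hK
  have hK0 : 0 < K := by positivity
  set ε : NNReal := min 1 (η / K ^ Module.finrank ℝ E) with hε
  have hε0 : 0 < ε := lt_min one_pos (by positivity)
  have hε1 : (ε : ℝ) ≤ 1 := by exact_mod_cast min_le_left _ _
  have hKε : K ^ Module.finrank ℝ E * ε ≤ η := by
    refine (mul_le_mul_right (min_le_right _ _) _).trans_eq ?_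
    field_simp
  let L : E →ₗ[ℝ] E := LinearMap.transvection (((ε : ℝ) - 1) • (innerₗ E v)) v
  have hL : ∀ t, L t = t + (((ε : ℝ) - 1) * inner ℝ v t) • v := fun t => by
    simp [L, LinearMap.transvection.apply]
  have hdet : LinearMap.det L = ε := by
    simp [L, LinearMap.transvection.det, hv]
  have hbound : ∀ t : E, ‖A t‖ + ε * ‖t‖ ≤ K * ‖L t‖ := by
    intro t
    set c : ℝ := inner ℝ v t with hc
    have hvL : inner ℝ v (L t) = ε * c := by
      rw [hL, inner_add_right, inner_smul_right, real_inner_self_eq_norm_sq, hv]; ring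
    have hcL : ε * |c| ≤ ‖L t‖ := by
      have := abs_real_inner_le_norm v (L t)
      rwa [hvL, hv, one_mul, abs_mul, abs_of_nonneg ε.coe_nonneg] at this
    have hu : t - c • v = L t - (ε * c) • v := by
      rw [hL]; module
    have hun : ‖t - c • v‖ ≤ 2 * ‖L t‖ := by
      rw [hu]
      refine (norm_sub_le _ _).trans ?_
      rw [norm_smul, hv, mul_one, Real.norm_eq_abs, abs_mul, abs_of_nonneg ε.coe_nonneg]
      linarith
    have hA1 : ‖A t‖ ≤ ‖A‖ * (2 * ‖L t‖) := by
      have : A t = A (t - c • v) := by simp [hAv]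
      rw [this]
      exact (A.le_opNorm _).trans (by gcongr)
    have hA2 : ‖t‖ ≤ ‖t - c • v‖ + |c| := by
      have := norm_add_le (t - c • v) (c • v)
      rwa [sub_add_cancel, norm_smul, hv, mul_one, Real.norm_eq_abs] at this
    have hA3 : ε * ‖t‖ ≤ 3 * ‖L t‖ := by
      nlinarith [mul_le_mul_of_nonneg_left (hA2.trans (add_le_add_left hun _)) ε.coe_nonneg,
        norm_nonneg (L t)]
    have hKr : (K : ℝ) = 2 * ‖A‖ + 3 := by simp [hK]
    rw [hKr]
    linarith
  refine ⟨ε, hε0, fun f s hfs => ?_⟩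
  have hdist : ∀ a ∈ s, ∀ b ∈ s, dist (f a) (f b) ≤ K * dist (L a) (L b) := by
    intro a ha b hb
    rw [dist_eq_norm, dist_eq_norm, ← map_sub]
    refine le_trans ?_ (hbound (a - b))
    have h1 := hfs a ha b hb
    have h2 := norm_add_le (A (a - b)) (f a - f b - A (a - b))
    rw [add_sub_cancel] at h2
    linarith
  refine (hausdorffMeasure_image_le_of_dist_le (Nat.cast_nonneg _) hdist).trans ?_
  rw [Measure.addHaar_image_linearMap, hdet, ← mul_assoc, ENNReal.rpow_natCast]
  gcongr
  rw [abs_of_nonneg ε.coe_nonneg, ENNReal.ofReal_coe_nnreal]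
  exact_mod_cast hKε

/-- Sard's theorem for critical points of maps into a space of larger dimension. -/
lemma hausdorffMeasure_image_eq_zero_of_not_injective [SecondCountableTopology F]
    {f : E → F} {f' : E → E →L[ℝ] F} {s : Set E}
    (hf' : ∀ x ∈ s, HasFDerivWithinAt f (f' x) s x)
    (h : ∀ x ∈ s, ¬ Function.Injective (f' x)) :
    μH[(Module.finrank ℝ E : ℝ)] (f '' s) = 0 := by
  wlog hs : μH[(Module.finrank ℝ E : ℝ)] s < ∞ generalizing s
  · have hcover : f '' s ⊆ ⋃ k : ℕ, f '' (s ∩ closedBall 0 k) := by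
      rintro _ ⟨x, hx, rfl⟩
      obtain ⟨k, hk⟩ := exists_nat_ge ‖x‖
      exact mem_iUnion.2 ⟨k, x, ⟨hx, by simpa using hk⟩, rfl⟩
    refine measure_mono_null hcover (measure_iUnion_null fun k => this ?_ ?_ ?_)
    · exact fun x hx => (hf' x hx.1).mono inter_subset_left
    · exact fun x hx => h x hx.1
    · exact (measure_mono inter_subset_right).trans_lt measure_closedBall_lt_top
  rcases s.eq_empty_or_nonempty with rfl | hne
  · simp
  have key : ∀ η : NNReal, 0 < η →
      μH[(Module.finrank ℝ E : ℝ)] (f '' s) ≤ η * μH[(Module.finrank ℝ E : ℝ)] s := by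
    intro η hη
    have hex : ∀ A : E →L[ℝ] F, ∃ δ : NNReal, δ ≠ 0 ∧ (¬ Function.Injective A →
        ∀ (f : E → F) (s : Set E), ApproximatesLinearOn f A s δ →
        μH[(Module.finrank ℝ E : ℝ)] (f '' s) ≤ η * μH[(Module.finrank ℝ E : ℝ)] s) := by
      intro A
      by_cases hA : Function.Injective A
      · exact ⟨1, one_ne_zero, fun h => absurd hA h⟩
      · obtain ⟨δ, hδ, H⟩ := exists_hausdorffMeasure_image_le_of_not_injective A hA hη
        exact ⟨δ, hδ.ne', fun _ => H⟩
    choose r hr0 hr using hex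
    obtain ⟨t, A, hdisj, hmeas, hst, happ, hA⟩ :=
      exists_partition_approximatesLinearOn_of_hasFDerivWithinAt f s f' hf' r hr0
    calc μH[(Module.finrank ℝ E : ℝ)] (f '' s)
        ≤ μH[(Module.finrank ℝ E : ℝ)] (⋃ k, f '' (s ∩ t k)) := by
          rw [← image_iUnion, ← inter_iUnion, inter_eq_left.2 hst]
      _ ≤ ∑' k, μH[(Module.finrank ℝ E : ℝ)] (f '' (s ∩ t k)) := measure_iUnion_le _
      _ ≤ ∑' k, η * μH[(Module.finrank ℝ E : ℝ)] (s ∩ t k) := by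
          refine ENNReal.tsum_le_tsum fun k => hr (A k) ?_ f _ (happ k)
          obtain ⟨y, hy, hAy⟩ := hA hne k
          exact hAy ▸ h y hy
      _ = η * μH[(Module.finrank ℝ E : ℝ)] s := by
          rw [ENNReal.tsum_mul_left]
          congr 1
          have := measure_iUnion (μ := (μH[(Module.finrank ℝ E : ℝ)]).restrict s) hdisj hmeas
          simp_rw [Measure.restrict_apply (hmeas _)] at this
          rw [Measure.restrict_apply (MeasurableSet.iUnion hmeas), inter_comm,
            inter_eq_left.2 hst] at this
          simp_rw [inter_comm s, this]
  generalize μH[(Module.finrank ℝ E : ℝ)] s = M at hs key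
  refine le_antisymm (ENNReal.le_of_forall_pos_le_add fun ε hε _ => ?_) zero_le
  lift M to NNReal using hs.ne
  refine (key (ε / (M + 1)) (by positivity)).trans ?_
  rw [zero_add]
  norm_cast
  rw [div_mul_eq_mul_div, div_le_iff₀ (by positivity)]
  gcongr
  simp

/-- Differentiable maps send null sets to null sets for the Hausdorff measure in the dimension of
the source. -/
lemma hausdorffMeasure_image_eq_zero_of_null [SecondCountableTopology F]
    {f : E → F} {f' : E → E →L[ℝ] F} {s : Set E}
    (hf' : ∀ x ∈ s, HasFDerivWithinAt f (f' x) s x)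
    (hs : μH[(Module.finrank ℝ E : ℝ)] s = 0) :
    μH[(Module.finrank ℝ E : ℝ)] (f '' s) = 0 := by
  obtain ⟨t, A, -, -, hst, happ, -⟩ :=
    exists_partition_approximatesLinearOn_of_hasFDerivWithinAt f s f' hf' (fun _ => 1)
      (fun _ => one_ne_zero)
  rw [← inter_eq_left.2 hst, inter_iUnion, image_iUnion]
  refine measure_iUnion_null fun k => ?_
  have hle := (lipschitzOnWith_iff_restrict.2 (happ k).lipschitz).hausdorffMeasure_image_le
    (Nat.cast_nonneg (Module.finrank ℝ E))
  rw [measure_mono_null inter_subset_left hs, mul_zero] at hle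
  exact le_antisymm hle zero_le

/-- If the image of a set under a map with injective derivatives is null, then so is the set. -/
lemma hausdorffMeasure_eq_zero_of_image_of_injective [SecondCountableTopology F]
    {f : E → F} {f' : E → E →L[ℝ] F} {s : Set E}
    (hf' : ∀ x ∈ s, HasFDerivWithinAt f (f' x) s x)
    (h : ∀ x ∈ s, Function.Injective (f' x))
    (hs : μH[(Module.finrank ℝ E : ℝ)] (f '' s) = 0) :
    μH[(Module.finrank ℝ E : ℝ)] s = 0 := by
  rcases s.eq_empty_or_nonempty with rfl | hne
  · simp
  have hex : ∀ A : E →L[ℝ] F, ∃ δ : NNReal, δ ≠ 0 ∧ (Function.Injective A →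
      ∀ v, δ * ‖v‖ ≤ ‖A v‖ / 2) := by
    intro A
    by_cases hA : Function.Injective A
    · obtain ⟨K, hK, hAK⟩ := (A : E →ₗ[ℝ] F).exists_antilipschitzWith (LinearMap.ker_eq_bot.2 hA)
      refine ⟨K⁻¹ / 2, by positivity, fun _ v => ?_⟩
      have := hAK.le_mul_dist v 0
      simp only [map_zero, dist_zero_right, ContinuousLinearMap.coe_coe] at this
      push_cast
      have hK' : (0 : ℝ) < K := hK
      rw [div_mul_eq_mul_div, div_le_div_iff_of_pos_right two_pos, inv_mul_le_iff₀ hK']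
      exact this
    · exact ⟨1, one_ne_zero, fun h => absurd h hA⟩
  choose r hr0 hr using hex
  obtain ⟨t, A, -, -, hst, happ, hA⟩ :=
    exists_partition_approximatesLinearOn_of_hasFDerivWithinAt f s f' hf' r hr0
  rw [← inter_eq_left.2 hst, inter_iUnion]
  refine measure_iUnion_null fun k => ?_
  have hinj : Function.Injective (A k) := by
    obtain ⟨y, hy, hAy⟩ := hA hne k
    exact hAy ▸ h y hy
  have hdist : ∀ a ∈ s ∩ t k, ∀ b ∈ s ∩ t k,
      dist (id a) (id b) ≤ (r (A k))⁻¹ * dist (f a) (f b) := by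
    intro a ha b hb
    have hpos : (0 : ℝ) < r (A k) := NNReal.coe_pos.2 (pos_iff_ne_zero.2 (hr0 _))
    rw [NNReal.coe_inv, inv_mul_eq_div, le_div_iff₀ hpos, mul_comm, dist_eq_norm, dist_eq_norm]
    have h1 := happ k a ha b hb
    have h2 := hr (A k) hinj (a - b)
    have h3 := norm_sub_norm_le (A k (a - b)) (f a - f b)
    rw [norm_sub_rev (A k (a - b)) (f a - f b)] at h3
    simp only [id]
    linarith
  have hle := hausdorffMeasure_image_le_of_dist_le (Nat.cast_nonneg (Module.finrank ℝ E)) hdist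
  rw [measure_mono_null (image_mono inter_subset_left) hs, mul_zero, image_id] at hle
  exact le_antisymm hle zero_le

end HausdorffMeasureImage

/-- Differentiability of the radial projection along a map, with a description of the kernel. -/
lemma exists_hasFDerivAt_radialProj_comp {E : Type*} [NormedAddCommGroup E] [NormedSpace ℝ E]
    {n : ℕ} {f : E → EuclideanSpace ℝ (Fin n)} {f' : E →L[ℝ] EuclideanSpace ℝ (Fin n)} {t : E}
    (hf : HasFDerivAt f f' t) {x : EuclideanSpace ℝ (Fin n)} (hx : f t ≠ x) :
    ∃ h' : E →L[ℝ] EuclideanSpace ℝ (Fin n), HasFDerivAt (fun s => radialProj x (f s)) h' t ∧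
      ∀ v, h' v = 0 → ∃ c : ℝ, f' v = c • (f t - x) := by
  have hne : f t - x ≠ 0 := sub_ne_zero.2 hx
  have hsub : HasFDerivAt (fun s => f s - x) f' t := hf.sub_const x
  obtain ⟨ℓ, hℓ⟩ : ∃ ℓ : E →L[ℝ] ℝ, HasFDerivAt (fun s => ‖f s - x‖⁻¹) ℓ t :=
    ⟨_, ((hsub.differentiableAt.norm ℝ hne).inv (norm_ne_zero_iff.2 hne)).hasFDerivAt⟩
  refine ⟨_, hℓ.smul hsub, fun v hv => ⟨-(‖f t - x‖ * ℓ v), ?_⟩⟩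
  simp only [add_apply, smul_apply,
    ContinuousLinearMap.smulRight_apply] at hv
  have := congrArg (fun w => ‖f t - x‖ • w) (eq_neg_of_add_eq_zero_left hv)
  simp only [smul_inv_smul₀ (norm_ne_zero_iff.2 hne)] at this
  rw [this, smul_neg, smul_smul, neg_smul]

/-- The critical values of a differentiable map `ℝᵐ → ℝⁿ` form an `ℋᵐ`-null set. -/
lemma hausdorffMeasure_image_critical_eq_zero {m n : ℕ}
    {f : EuclideanSpace ℝ (Fin m) → EuclideanSpace ℝ (Fin n)} (hf : Differentiable ℝ f) :
    μH[(m : ℝ)] (f '' {t | ¬ Function.Injective (fderiv ℝ f t)}) = 0 := by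
  have hd : ((Module.finrank ℝ (EuclideanSpace ℝ (Fin m)) : ℕ) : ℝ) = m := by simp
  rw [← hd]
  exact hausdorffMeasure_image_eq_zero_of_not_injective
    (fun t _ => (hf t).hasFDerivAt.hasFDerivWithinAt) (fun t ht => ht)

/-- If the radial projection of `E` from `x` is null, then at almost every point of `E` on a
parametrized surface, the tangent plane of the surface passes through `x`. -/
lemma hausdorffMeasure_image_eq_zero_of_radialProj {m n : ℕ}
    {E : Set (EuclideanSpace ℝ (Fin n))} {x : EuclideanSpace ℝ (Fin n)}
    (hx : μH[(m : ℝ)] (radialProj x '' (E \ {x})) = 0)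
    {f : EuclideanSpace ℝ (Fin m) → EuclideanSpace ℝ (Fin n)} (hf : Differentiable ℝ f) :
    μH[(m : ℝ)] (f '' {t | f t ∈ E ∧ Function.Injective (fderiv ℝ f t) ∧
      f t - x ∉ (fderiv ℝ f t).range}) = 0 := by
  set B := {t | f t ∈ E ∧ Function.Injective (fderiv ℝ f t) ∧
    f t - x ∉ (fderiv ℝ f t).range} with hB
  have hne : ∀ t ∈ B, f t ≠ x := by
    rintro t ⟨-, -, ht⟩ rfl
    exact ht (by simp)
  have hd : ((Module.finrank ℝ (EuclideanSpace ℝ (Fin m)) : ℕ) : ℝ) = m := by simp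
  have hder : ∀ t, ∃ h' : EuclideanSpace ℝ (Fin m) →L[ℝ] EuclideanSpace ℝ (Fin n), t ∈ B →
      HasFDerivAt (fun s => radialProj x (f s)) h' t ∧
      ∀ v, h' v = 0 → ∃ c : ℝ, fderiv ℝ f t v = c • (f t - x) := by
    intro t
    by_cases ht : t ∈ B
    · obtain ⟨h', hh'⟩ := exists_hasFDerivAt_radialProj_comp (hf t).hasFDerivAt (hne t ht)
      exact ⟨h', fun _ => hh'⟩
    · exact ⟨0, fun h => absurd h ht⟩
  choose h' hh' using hder
  rw [← hd]
  refine hausdorffMeasure_image_eq_zero_of_null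
    (fun t _ => (hf t).hasFDerivAt.hasFDerivWithinAt) ?_
  refine hausdorffMeasure_eq_zero_of_image_of_injective
    (fun t ht => (hh' t ht).1.hasFDerivWithinAt) (fun t ht => ?_) ?_
  · refine (injective_iff_map_eq_zero _).2 fun v hv => ?_
    obtain ⟨c, hc⟩ := (hh' t ht).2 v hv
    rcases eq_or_ne c 0 with rfl | hc0
    · exact ht.2.1 (by simpa using hc)
    · exact absurd ⟨c⁻¹ • v, by simp [hc, smul_smul, hc0]⟩ ht.2.2
  · rw [hd]
    refine measure_mono_null ?_ hx
    rintro _ ⟨t, ht, rfl⟩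
    exact ⟨f t, ⟨ht.1, hne t ht⟩, rfl⟩

/-- A subspace of small dimension is contained in a subspace of any larger given dimension. -/
lemma Submodule.exists_le_finrank_eq {V : Type*} [AddCommGroup V] [Module ℝ V]
    [FiniteDimensional ℝ V] (W : Submodule ℝ V) {k : ℕ} (hW : Module.finrank ℝ W ≤ k)
    (hk : k ≤ Module.finrank ℝ V) : ∃ W' : Submodule ℝ V, W ≤ W' ∧ Module.finrank ℝ W' = k := by
  induction k, hW using Nat.le_induction with
  | base => exact ⟨W, le_rfl, rfl⟩
  | succ k _ ih =>
    obtain ⟨W', hle, hfr⟩ := ih (by omega)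
    obtain ⟨v, hv⟩ : ∃ v, v ∉ W' := by
      by_contra! h
      have : W' = ⊤ := (Submodule.eq_top_iff').2 h
      rw [this, finrank_top] at hfr
      omega
    refine ⟨W' ⊔ Submodule.span ℝ {v}, hle.trans le_sup_left, ?_⟩
    have h1 := Submodule.finrank_sup_add_finrank_inf_eq W' (Submodule.span ℝ {v})
    have hv0 : v ≠ 0 := fun h => hv (h ▸ W'.zero_mem)
    have h2 : W' ⊓ Submodule.span ℝ {v} = ⊥ := by
      rw [← disjoint_iff, Submodule.disjoint_span_singleton' hv0]
      exact hv
    rw [h2, finrank_bot, finrank_span_singleton hv0] at h1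
    omega

/-- A set spanning a space of dimension at least `k` contains `k` independent vectors. -/
lemma exists_finset_subset_finrank_span_eq {V : Type*} [AddCommGroup V] [Module ℝ V]
    [FiniteDimensional ℝ V] {S : Set V} {k : ℕ} (hk : k ≤ Module.finrank ℝ (Submodule.span ℝ S)) :
    ∃ F : Finset V, (F : Set V) ⊆ S ∧
      Module.finrank ℝ (Submodule.span ℝ (F : Set V)) = k := by
  obtain ⟨b, hbS, hspan, hli⟩ := exists_linearIndependent ℝ S
  have : Fintype b := hli.setFinite.fintype
  have hcard : k ≤ b.toFinset.card := by
    rwa [← finrank_span_set_eq_card hli, hspan]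
  obtain ⟨F, hFb, hF⟩ := Finset.exists_subset_card_eq hcard
  have hFb' : (F : Set V) ⊆ b := fun v hv => by simpa using hFb hv
  refine ⟨F, hFb'.trans hbS, ?_⟩
  rw [finrank_span_finset_eq_card (LinearIndepOn.mono hli hFb'), hF]

/-- If `E ⊆ ℝⁿ` is `m`-rectifiable and not essentially `m`-flat, then the exceptional set
`{x : ℋᵐ(π_x(E \ {x})) = 0}` is contained in some affine `(m-1)`-plane. -/
theorem stmt1 {n m : ℕ} (hm : 0 < m) (hmn : m < n)
    (E : Set (EuclideanSpace ℝ (Fin n)))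
    (hE : IsRectifiableSet m n E)
    (hflat : ¬ ∃ T : Set (EuclideanSpace ℝ (Fin n)), IsAffinePlane m T ∧ μH[(m : ℝ)] (E \ T) = 0) :
    ∃ V : Set (EuclideanSpace ℝ (Fin n)), IsAffinePlane (m - 1) V ∧
      {x : EuclideanSpace ℝ (Fin n) | μH[(m : ℝ)] (radialProj x '' (E \ {x})) = 0} ⊆ V := by
  obtain ⟨-, -, f, hf, hcover⟩ := hE
  set X := {x : EuclideanSpace ℝ (Fin n) | μH[(m : ℝ)] (radialProj x '' (E \ {x})) = 0} with hX
  have hnfin : Module.finrank ℝ (EuclideanSpace ℝ (Fin n)) = n := by simp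
  rcases X.eq_empty_or_nonempty with hX0 | ⟨x₀, hx₀⟩
  · obtain ⟨W, -, hW⟩ := Submodule.exists_le_finrank_eq
      (⊥ : Submodule ℝ (EuclideanSpace ℝ (Fin n))) (k := m - 1) (by simp) (by omega)
    exact ⟨_, ⟨W, 0, hW, rfl⟩, by simp [hX0]⟩
  set S : Set (EuclideanSpace ℝ (Fin n)) := (fun x => x - x₀) '' X with hS
  rcases lt_or_ge (Module.finrank ℝ (Submodule.span ℝ S)) m with hlt | hge
  · obtain ⟨W, hSW, hW⟩ := Submodule.exists_le_finrank_eq (Submodule.span ℝ S) (k := m - 1)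
      (by omega) (by omega)
    refine ⟨_, ⟨W, x₀, hW, rfl⟩, fun x hx => ⟨x - x₀, ?_, by simp⟩⟩
    exact hSW (Submodule.subset_span (mem_image_of_mem _ hx))
  exfalso
  obtain ⟨F, hFS, hF⟩ := exists_finset_subset_finrank_span_eq hge
  apply hflat
  refine ⟨(fun w => x₀ + w) '' (Submodule.span ℝ (F : Set (EuclideanSpace ℝ (Fin n))) :
    Set (EuclideanSpace ℝ (Fin n))), ⟨Submodule.span ℝ F, x₀, hF, rfl⟩, ?_⟩
  have hdiff : ∀ i, Differentiable ℝ (f i) := fun i => (hf i).1.differentiable one_ne_zero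
  have hcrit : ∀ i, μH[(m : ℝ)] (f i '' {t | ¬ Function.Injective (fderiv ℝ (f i) t)}) = 0 :=
    fun i => hausdorffMeasure_image_critical_eq_zero (hdiff i)
  let B (i : ℕ) (x : EuclideanSpace ℝ (Fin n)) : Set (EuclideanSpace ℝ (Fin n)) :=
    f i '' {t | f i t ∈ E ∧ Function.Injective (fderiv ℝ (f i) t) ∧
      f i t - x ∉ (fderiv ℝ (f i) t).range}
  have hBnull : ∀ i, ∀ x ∈ X, μH[(m : ℝ)] (B i x) = 0 := fun i x hx =>
    hausdorffMeasure_image_eq_zero_of_radialProj hx (hdiff i)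
  have hFX : ∀ w ∈ F, w + x₀ ∈ X := by
    intro w hw
    obtain ⟨x, hx, rfl⟩ := hFS hw
    simpa using hx
  have hnull : μH[(m : ℝ)] ((E \ ⋃ i, range (f i)) ∪
      ⋃ i, (f i '' {t | ¬ Function.Injective (fderiv ℝ (f i) t)} ∪
        (B i x₀ ∪ ⋃ w ∈ F, B i (w + x₀)))) = 0 := by
    refine measure_union_null hcover (measure_iUnion_null fun i => measure_union_null (hcrit i) <|
      measure_union_null (hBnull i x₀ hx₀) ?_)
    exact (measure_biUnion_null_iff F.countable_toSet).2 fun w hw => hBnull i _ (hFX w hw)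
  refine measure_mono_null ?_ hnull
  rintro y ⟨hyE, hyT⟩
  by_contra hy
  simp only [mem_union, mem_iUnion, not_or, not_exists] at hy
  obtain ⟨hy1, hy2⟩ := hy
  obtain ⟨i, t, rfl⟩ : ∃ i t, f i t = y := by
    by_contra! h
    exact hy1 ⟨hyE, by simpa using h⟩
  obtain ⟨hinj, hBx₀, hBw⟩ := hy2 i
  have hinj : Function.Injective (fderiv ℝ (f i) t) := by
    by_contra h
    exact hinj ⟨t, h, rfl⟩
  have hmem : ∀ x, f i t ∉ B i x → f i t - x ∈ (fderiv ℝ (f i) t).range := by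
    intro x hx
    by_contra h
    exact hx ⟨t, ⟨hyE, hinj, h⟩, rfl⟩
  have hle : Submodule.span ℝ (F : Set (EuclideanSpace ℝ (Fin n))) ≤
      (fderiv ℝ (f i) t).range := by
    rw [Submodule.span_le]
    intro w hw
    have := Submodule.sub_mem _ (hmem x₀ hBx₀) (hmem (w + x₀) (hBw w hw))
    simpa using this
  have heq := Submodule.eq_of_le_of_finrank_eq hle (by
    rw [hF]
    exact ((LinearMap.finrank_range_of_inj hinj).trans finrank_euclideanSpace_fin).symm)
  exact hyT ⟨f i t - x₀, heq ▸ hmem x₀ hBx₀, by simp⟩
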